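/- Suppose the automorphism f₀ of the linear system is the inner automorphism by a fixed element z ∈ G, i.e. f₀(x) = z x z⁻¹ for all x ∈ G. Then the set 𝒮 = ⋃_{k ≥ 1} {x · zᵏ : x ∈ R_k} is closed under multiplication (it is a subsemigroup of G); more precisely, if x₁ ∈ R_{k₁}·z^{k₁} and x₂ ∈ R_{k₂}·z^{k₂}, then x₁x₂ ∈ R_{k₁+k₂}·z^{k₁+k₂}. -/

import Mathlib

open Pointwise

/-- The solution of a discrete-time linear control system:
`phi f₀ b 0 x u = x`, `phi f₀ b (k+1) x u = b (u k) * f₀ (phi f₀ b k x u)`. -/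
def phi {G : Type*} [Group G] {U : Type*} (f₀ : G ≃* G) (b : U → G) :
    ℕ → G → (ℕ → U) → G
  | 0, x, _ => x
  | k + 1, x, u => b (u k) * f₀ (phi f₀ b k x u)

/-- The reachable set from `x` at time `k`. -/
def reach {G : Type*} [Group G] {U : Type*} (f₀ : G ≃* G) (b : U → G)
    (k : ℕ) (x : G) : Set G :=
  {y | ∃ u : ℕ → U, phi f₀ b k x u = y}

theorem phi_congr {G : Type*} [Group G] {U : Type*} (f₀ : G ≃* G) (b : U → G) (x : G)
    {u v : ℕ → U} {k : ℕ} (h : ∀ i < k, u i = v i) : phi f₀ b k x u = phi f₀ b k x v := by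
  induction k with
  | zero => rfl
  | succ k ih =>
    simp only [phi]
    rw [h k k.lt_succ_self, ih fun i hi => h i (hi.trans k.lt_succ_self)]

/-- The solution property (cocycle identity) of the control system. -/
theorem phi_add {G : Type*} [Group G] {U : Type*} (f₀ : G ≃* G) (b : U → G) (x : G)
    (u : ℕ → U) (k l : ℕ) :
    phi f₀ b (k + l) x u = phi f₀ b l (phi f₀ b k x u) fun i => u (k + i) := by
  induction l with
  | zero => rfl
  | succ l ih => exact congrArg (fun y => b (u (k + l)) * f₀ y) ih

/-- For an inner drift, translating by `z ^ k` turns the initial value into a right factor. -/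
theorem phi_mul_pow_of_inner {G : Type*} [Group G] {U : Type*} (f₀ : G ≃* G) (b : U → G)
    {z : G} (hf₀ : ∀ x, f₀ x = z * x * z⁻¹) (x : G) (u : ℕ → U) (k : ℕ) :
    phi f₀ b k x u * z ^ k = phi f₀ b k 1 u * z ^ k * x := by
  induction k with
  | zero => simp [phi]
  | succ k ih =>
    simp only [phi, hf₀, pow_succ', mul_assoc, inv_mul_cancel_left] at ih ⊢
    rw [ih]

theorem mul_mem_translate_reach {G : Type*} [Group G] {U : Type*} (f₀ : G ≃* G) (b : U → G)
    {z : G} (hf₀ : ∀ x, f₀ x = z * x * z⁻¹) {k₁ k₂ : ℕ} {x₁ x₂ : G}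
    (h₁ : x₁ ∈ (fun x => x * z ^ k₁) '' reach f₀ b k₁ 1)
    (h₂ : x₂ ∈ (fun x => x * z ^ k₂) '' reach f₀ b k₂ 1) :
    x₁ * x₂ ∈ (fun x => x * z ^ (k₁ + k₂)) '' reach f₀ b (k₁ + k₂) 1 := by
  obtain ⟨_, ⟨u₁, rfl⟩, rfl⟩ := h₁
  obtain ⟨_, ⟨u₂, rfl⟩, rfl⟩ := h₂
  let w : ℕ → U := fun i => if i < k₂ then u₂ i else u₁ (i - k₂)
  refine ⟨_, ⟨w, rfl⟩, ?_⟩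
  have hw₂ : phi f₀ b k₂ 1 w = phi f₀ b k₂ 1 u₂ :=
    phi_congr f₀ b 1 fun i hi => if_pos hi
  have hw₁ : (fun i => w (k₂ + i)) = u₁ := by
    funext i
    simp [w]
  dsimp only
  rw [add_comm k₁ k₂, phi_add, hw₂, hw₁, add_comm k₂ k₁, pow_add, ← mul_assoc,
    phi_mul_pow_of_inner f₀ b hf₀, mul_assoc]

/-- if f₀ is the inner automorphism by z, then
𝒮 = ⋃_{k ≥ 1} R_k · zᵏ is a subsemigroup of G; more precisely,
x₁ ∈ R_{k₁}·z^{k₁} and x₂ ∈ R_{k₂}·z^{k₂} imply x₁x₂ ∈ R_{k₁+k₂}·z^{k₁+k₂}. -/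
theorem semigroup_of_translates {G : Type*} [Group G] {U : Type*} [Zero U]
    (f₀ : G ≃* G) (b : U → G) (hb : b 0 = 1) (z : G)
    (hf₀ : ∀ x, f₀ x = z * x * z⁻¹) :
    (∀ x₁ ∈ ⋃ k ≥ 1, (fun x => x * z ^ k) '' reach f₀ b k 1,
      ∀ x₂ ∈ ⋃ k ≥ 1, (fun x => x * z ^ k) '' reach f₀ b k 1,
        x₁ * x₂ ∈ ⋃ k ≥ 1, (fun x => x * z ^ k) '' reach f₀ b k 1) ∧
    ∀ (k₁ k₂ : ℕ), 1 ≤ k₁ → 1 ≤ k₂ →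
      ∀ x₁ ∈ (fun x => x * z ^ k₁) '' reach f₀ b k₁ 1,
      ∀ x₂ ∈ (fun x => x * z ^ k₂) '' reach f₀ b k₂ 1,
        x₁ * x₂ ∈ (fun x => x * z ^ (k₁ + k₂)) '' reach f₀ b (k₁ + k₂) 1 := by
  refine ⟨fun x₁ h₁ x₂ h₂ => ?_,
    fun k₁ k₂ _ _ x₁ h₁ x₂ h₂ => mul_mem_translate_reach f₀ b hf₀ h₁ h₂⟩
  simp only [Set.mem_iUnion] at h₁ h₂ ⊢
  obtain ⟨k₁, hk₁, h₁⟩ := h₁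
  obtain ⟨k₂, _, h₂⟩ := h₂
  exact ⟨k₁ + k₂, Nat.le_add_right_of_le hk₁, mul_mem_translate_reach f₀ b hf₀ h₁ h₂⟩
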